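/- arXiv:1502.05232 — 3 statements merged into one kernel-verified Lean document; each statement's English description precedes it below -/
import Mathlib

section
/- Let (M,d) be a nonempty complete metric space and let f : M → ℝ be a continuous nonnegative function which is unbounded above (sup_{x∈M} f(x) = ∞). Fix real numbers β > 0, R > 0 and δ > 0. Then there exists a sequence (x_i)_{i≥1} of points of M such that for every integer i ≥ 1 one has f(x_i) ≥ i and sup { f(y) : y ∈ M, d(y, x_i) < R · f(x_i)^{-1/β} } ≤ (1+δ) · f(x_i). -/
/-- Lemma `seq-bddratio`: on a nonempty complete metric space, a continuous
nonnegative function `f` unbounded above admits a sequence `x i` with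
`f (x i) ≥ i` and `f ≤ (1+δ) f (x i)` on the ball of radius
`R * f (x i) ^ (-1/β)` around `x i`. -/
theorem seq_bddratio {M : Type*} [MetricSpace M] [CompleteSpace M] [Nonempty M]
    (f : M → ℝ) (hf_cont : Continuous f) (hf_nonneg : ∀ x, 0 ≤ f x)
    (hf_unbdd : ¬ BddAbove (Set.range f))
    (β R δ : ℝ) (hβ : 0 < β) (hR : 0 < R) (hδ : 0 < δ) :
    ∃ x : ℕ → M, ∀ i : ℕ, 1 ≤ i →
      (i : ℝ) ≤ f (x i) ∧
      ∀ y : M, dist y (x i) < R * (f (x i)) ^ (-(1 / β)) →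
        f y ≤ (1 + δ) * f (x i) := by
  have key : ∀ i : ℕ, ∃ x : M, 1 ≤ i →
      (i : ℝ) ≤ f x ∧
      ∀ y : M, dist y x < R * (f x) ^ (-(1 / β)) → f y ≤ (1 + δ) * f x := by
    intro i
    by_contra hcon
    push Not at hcon
    have hi : 1 ≤ i := (hcon (Classical.arbitrary M)).1
    have hi' : (1 : ℝ) ≤ i := by exact_mod_cast hi
    have hcon2 := fun x => (hcon x).2
    choose! g hg using hcon2
    obtain ⟨x0, hx0⟩ : ∃ x, (i : ℝ) ≤ f x := by
      by_contra hne
      push Not at hne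
      exact hf_unbdd ⟨i, by rintro _ ⟨x, rfl⟩; exact (hne x).le⟩
    have hg2 : ∀ x, (i : ℝ) ≤ f x → dist (g x) x < R * (f x) ^ (-(1 / β)) ∧
        (1 + δ) * f x < f (g x) := hg
    let u : ℕ → M := fun n => g^[n] x0
    have hu : ∀ n, u (n + 1) = g (u n) := fun n => Function.iterate_succ_apply' g n x0
    have hpow : ∀ n : ℕ, (1 : ℝ) ≤ (1 + δ) ^ n := fun n => one_le_pow₀ (by linarith)
    have hlow : ∀ n, (1 + δ) ^ n * (i : ℝ) ≤ f (u n) := by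
      intro n
      induction n with
      | zero => simpa [u] using hx0
      | succ n ih =>
        have h1 : (i : ℝ) ≤ f (u n) := by nlinarith [hpow n]
        have h2 := (hg2 _ h1).2
        rw [hu, pow_succ]
        nlinarith
    have hlow1 : ∀ n, (i : ℝ) ≤ f (u n) := fun n => by nlinarith [hpow n, hlow n]
    have hlow2 : ∀ n, (1 + δ) ^ n ≤ f (u n) := fun n => by nlinarith [hpow n, hlow n]
    have hr : (1 + δ) ^ (-(1 / β)) < 1 :=
      Real.rpow_lt_one_of_one_lt_of_neg (by linarith) (by
        have : 0 < 1 / β := by positivity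
        linarith)
    have hc : CauchySeq u := by
      refine cauchySeq_of_le_geometric ((1 + δ) ^ (-(1 / β))) R hr fun n => ?_
      rw [dist_comm, hu]
      refine (hg2 _ (hlow1 n)).1.le.trans ?_
      refine mul_le_mul_of_nonneg_left ?_ hR.le
      rw [← Real.rpow_natCast, ← Real.rpow_mul (by linarith), mul_comm,
        Real.rpow_mul (by linarith), Real.rpow_natCast]
      refine Real.rpow_le_rpow_of_nonpos (by linarith [hpow n]) (hlow2 n) ?_
      have : 0 < 1 / β := by positivity
      linarith
    obtain ⟨a, ha⟩ := cauchySeq_tendsto_of_complete hc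
    have h1 := (hf_cont.tendsto a).comp ha
    have h2 : Filter.Tendsto (f ∘ u) Filter.atTop Filter.atTop :=
      Filter.tendsto_atTop_mono hlow2 (tendsto_pow_atTop_atTop_of_one_lt (by linarith))
    exact not_tendsto_nhds_of_tendsto_atTop h2 _ h1
  choose x hx using key
  exact ⟨x, hx⟩
end

section
/- Let (M,d) be a metric space equipped with a Borel measure μ, let q ∈ (0,∞), C ≥ 0, γ > 0, ρ > 0 and K > 0. Let f : M → [0,∞) be a measurable function with ∫_M f^q dμ < ∞. Let (x_i)_{i∈ℕ} be a sequence of points of M such that the open balls B(x_i, ρ) are pairwise disjoint, μ(B(x_i, ρ)) ≥ K for all i, and for every i and every x ∈ B(x_i, ρ) one has f(x) ≥ f(x_i) − C · d(x, x_i)^γ. Then limsup_{i→∞} f(x_i) ≤ C · ρ^γ. -/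
open MeasureTheory Filter

/-- The contradiction argument in Lemma `0-bdd-sol`: if `f ≥ 0` is in `L^q`,
the balls `B(x i, ρ)` are pairwise disjoint with measure at least `K > 0`, and
`f y ≥ f (x i) - C * d(y, x i)^γ` on each such ball, then
`limsup f (x i) ≤ C ρ^γ`. -/
theorem limsup_le_of_disjoint_balls {M : Type*} [MetricSpace M] [MeasurableSpace M]
    [BorelSpace M] (μ : Measure M)
    (q C γ ρ K : ℝ) (hq : 0 < q) (hC : 0 ≤ C) (hγ : 0 < γ) (hρ : 0 < ρ) (hK : 0 < K)
    (f : M → ℝ) (hf_meas : Measurable f) (hf_nonneg : ∀ x, 0 ≤ f x)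
    (hf_int : ∫⁻ x, ENNReal.ofReal (f x ^ q) ∂μ < ⊤)
    (x : ℕ → M)
    (h_disj : Pairwise (Function.onFun Disjoint (fun i => Metric.ball (x i) ρ)))
    (h_vol : ∀ i, ENNReal.ofReal K ≤ μ (Metric.ball (x i) ρ))
    (h_holder : ∀ i, ∀ y ∈ Metric.ball (x i) ρ, f (x i) - C * dist y (x i) ^ γ ≤ f y) :
    limsup (fun i => f (x i)) atTop ≤ C * ρ ^ γ := by
  refine le_of_forall_pos_le_add fun ε hε => ?_
  have hsum : ∑' i, ∫⁻ y in Metric.ball (x i) ρ, ENNReal.ofReal (f y ^ q) ∂μ ≠ ⊤ := by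
    rw [← lintegral_iUnion (fun i => Metric.isOpen_ball.measurableSet) h_disj]
    exact ((setLIntegral_le_lintegral _ _).trans_lt hf_int).ne
  have htend := ENNReal.tendsto_atTop_zero_of_tsum_ne_top hsum
  have hpos : 0 < ENNReal.ofReal (ε ^ q) * ENNReal.ofReal K :=
    ENNReal.mul_pos (ENNReal.ofReal_pos.2 (Real.rpow_pos_of_pos hε q)).ne'
      (ENNReal.ofReal_pos.2 hK).ne'
  have hev := htend.eventually (gt_mem_nhds hpos)
  refine limsup_le_of_le ?_ ?_
  · exact IsBoundedUnder.isCoboundedUnder_le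
      (isBoundedUnder_of ⟨0, fun i => hf_nonneg (x i)⟩)
  · filter_upwards [hev] with i hi
    by_contra! hlt
    refine absurd hi (not_lt.2 ?_)
    calc ENNReal.ofReal (ε ^ q) * ENNReal.ofReal K
        ≤ ENNReal.ofReal (ε ^ q) * μ (Metric.ball (x i) ρ) := by
          gcongr
          exact h_vol i
      _ = ∫⁻ y in Metric.ball (x i) ρ, ENNReal.ofReal (ε ^ q) ∂μ := by
          rw [setLIntegral_const]
      _ ≤ _ := by
          refine setLIntegral_mono' Metric.isOpen_ball.measurableSet fun y hy => ?_
          have h1 := h_holder i y hy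
          have h2 : dist y (x i) ^ γ ≤ ρ ^ γ :=
            Real.rpow_le_rpow dist_nonneg (Metric.mem_ball.1 hy).le hγ.le
          have h3 := mul_le_mul_of_nonneg_left h2 hC
          exact ENNReal.ofReal_le_ofReal
            (Real.rpow_le_rpow hε.le (by linarith) hq.le)
end

section
/- Let n ≥ 1 be an integer, let Ω ⊆ ℝⁿ be open, let a > 0 be a real constant, let V : Ω → ℝ be continuous, and let f : Ω → ℝ be continuous and nonnegative. Let u : Ω → ℝ be continuous and nonnegative, let U = { x ∈ Ω : u(x) > 0 }, and assume u is twice continuously differentiable on the open set U and satisfies −a·∑_{i=1}^n ∂²u/∂x_i²(x) + V(x)·u(x) ≤ f(x) for all x ∈ U. Then for every smooth compactly supported function v : Ω → ℝ with v ≥ 0 one has ∫_Ω u(x) · ( −a·∑_{i=1}^n ∂²v/∂x_i²(x) + V(x)·v(x) ) dx ≤ ∫_Ω f(x)·v(x) dx. -/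
open MeasureTheory

/-- The second partial derivative `∂²g/∂x_i²` of a function `g : ℝⁿ → ℝ`. -/
noncomputable def secondPartial {n : ℕ} (g : (Fin n → ℝ) → ℝ) (i : Fin n)
    (x : Fin n → ℝ) : ℝ :=
  fderiv ℝ (fun y => fderiv ℝ g y (Pi.single i 1)) x (Pi.single i 1)

/-- The cutoff profile. -/
noncomputable def psiCut (ε t : ℝ) : ℝ := Real.smoothTransition (t / ε - 1)

/-- Its primitive. -/
noncomputable def phiCut (ε t : ℝ) : ℝ := ∫ s in (0 : ℝ)..t, psiCut ε s

lemma psiCut_contDiff (ε : ℝ) : ContDiff ℝ 2 (psiCut ε) := by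
  unfold psiCut
  exact Real.smoothTransition.contDiff.comp ((contDiff_id.div_const ε).sub contDiff_const)

lemma psiCut_mono {ε : ℝ} (hε : 0 < ε) : Monotone (psiCut ε) := by
  intro s t hst
  unfold psiCut
  apply Real.smoothTransition.monotone
  gcongr

lemma psiCut_zero {ε t : ℝ} (hε : 0 < ε) (ht : t ≤ ε) : psiCut ε t = 0 := by
  unfold psiCut
  apply Real.smoothTransition.zero_of_nonpos
  have : t / ε ≤ 1 := (div_le_one hε).2 ht
  linarith

lemma psiCut_one {ε t : ℝ} (hε : 0 < ε) (ht : 2 * ε ≤ t) : psiCut ε t = 1 := by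
  unfold psiCut
  apply Real.smoothTransition.one_of_one_le
  have : 2 ≤ t / ε := (le_div_iff₀ hε).2 ht
  linarith

lemma psiCut_nonneg (ε t : ℝ) : 0 ≤ psiCut ε t := Real.smoothTransition.nonneg _
lemma psiCut_le_one (ε t : ℝ) : psiCut ε t ≤ 1 := Real.smoothTransition.le_one _

lemma phiCut_hasDerivAt (ε t : ℝ) : HasDerivAt (phiCut ε) (psiCut ε t) t := by
  have hc := (psiCut_contDiff ε).continuous
  exact intervalIntegral.integral_hasDerivAt_right (hc.intervalIntegrable _ _)
    (hc.stronglyMeasurableAtFilter _ _) hc.continuousAt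

lemma phiCut_contDiff (ε : ℝ) : ContDiff ℝ 2 (phiCut ε) := by
  have h : deriv (phiCut ε) = psiCut ε := funext fun t => (phiCut_hasDerivAt ε t).deriv
  rw [show (2 : WithTop ℕ∞) = 1 + 1 by norm_num, contDiff_succ_iff_deriv]
  refine ⟨fun t => (phiCut_hasDerivAt ε t).differentiableAt, by simp, ?_⟩
  rw [h]
  exact (psiCut_contDiff ε).of_le (by norm_num)

lemma phiCut_zero {ε t : ℝ} (hε : 0 < ε) (ht : t ≤ ε) : phiCut ε t = 0 := by
  unfold phiCut
  rw [intervalIntegral.integral_congr (g := fun _ => (0 : ℝ))]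
  · simp
  · intro s hs
    apply psiCut_zero hε
    exact hs.2.trans (max_le hε.le ht)

lemma phiCut_le {ε t : ℝ} (ht : 0 ≤ t) : phiCut ε t ≤ t := by
  have hc := (psiCut_contDiff ε).continuous
  have := intervalIntegral.integral_mono_on ht (hc.intervalIntegrable 0 t)
    (continuous_const.intervalIntegrable (μ := volume) 0 t) (fun s _ => psiCut_le_one ε s)
  simpa [phiCut] using this

lemma phiCut_nonneg {ε t : ℝ} (ht : 0 ≤ t) : 0 ≤ phiCut ε t :=
  intervalIntegral.integral_nonneg ht (fun s _ => psiCut_nonneg ε s)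

lemma phiCut_ge {ε t : ℝ} (hε : 0 < ε) (ht : 0 ≤ t) : t - 2 * ε ≤ phiCut ε t := by
  rcases le_total t (2 * ε) with h | h
  · linarith [phiCut_nonneg (ε := ε) ht]
  · have hc := (psiCut_contDiff ε).continuous
    have h1 := intervalIntegral.integral_add_adjacent_intervals
      (hc.intervalIntegrable (μ := volume) 0 (2 * ε)) (hc.intervalIntegrable (2 * ε) t)
    have h2 : ∫ s in (2 * ε)..t, psiCut ε s = t - 2 * ε := by
      rw [intervalIntegral.integral_congr (g := fun _ => (1 : ℝ))]
      · simp
      · intro s hs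
        rw [Set.uIcc_of_le h] at hs
        exact psiCut_one hε hs.1
    have h3 : 0 ≤ ∫ s in (0 : ℝ)..(2 * ε), psiCut ε s :=
      intervalIntegral.integral_nonneg (by linarith) (fun s _ => psiCut_nonneg ε s)
    unfold phiCut
    linarith

lemma psiCut_mul {ε t : ℝ} (hε : 0 < ε) (ht : 0 ≤ t) : |psiCut ε t * t - t| ≤ 2 * ε := by
  have h0 := psiCut_nonneg ε t
  have h1 := psiCut_le_one ε t
  rcases le_total t (2 * ε) with h | h
  · rw [abs_le]; constructor <;> nlinarith
  · rw [psiCut_one hε h]; simp; exact hε.le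

section
variable {n : ℕ}

lemma contDiffAt_partial {g : (Fin n → ℝ) → ℝ} {x : Fin n → ℝ} (hg : ContDiffAt ℝ 2 g x)
    (e : Fin n → ℝ) : ContDiffAt ℝ 1 (fun y => fderiv ℝ g y e) x :=
  (hg.fderiv_right (m := 1) (by norm_num)).clm_apply contDiffAt_const

lemma secondPartial_congr {g h : (Fin n → ℝ) → ℝ} {x : Fin n → ℝ} (hgh : g =ᶠ[nhds x] h)
    (i : Fin n) : secondPartial g i x = secondPartial h i x := by
  unfold secondPartial
  have : (fun y => fderiv ℝ g y (Pi.single i 1)) =ᶠ[nhds x]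
      (fun y => fderiv ℝ h y (Pi.single i 1)) := by
    filter_upwards [hgh.fderiv (𝕜 := ℝ)] with y hy
    rw [hy]
  rw [this.fderiv_eq]

lemma secondPartial_zero (i : Fin n) (x : Fin n → ℝ) :
    secondPartial (fun _ : Fin n → ℝ => (0 : ℝ)) i x = 0 := by
  simp [secondPartial]

lemma eventually_zero {v : (Fin n → ℝ) → ℝ} {x : Fin n → ℝ} (hx : x ∉ tsupport v) :
    v =ᶠ[nhds x] (fun _ => (0 : ℝ)) := by
  have := notMem_tsupport_iff_eventuallyEq.1 hx
  exact this

/-- Chain rule inequality. -/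
lemma secondPartial_phi_ge {ε : ℝ} (hε : 0 < ε) {u : (Fin n → ℝ) → ℝ} {x : Fin n → ℝ}
    (hu : ContDiffAt ℝ 2 u x) (i : Fin n) :
    psiCut ε (u x) * secondPartial u i x ≤ secondPartial (fun y => phiCut ε (u y)) i x := by
  set e : Fin n → ℝ := Pi.single i 1 with he
  have h1 : (fun y => fderiv ℝ (fun y => phiCut ε (u y)) y e) =ᶠ[nhds x]
      (fun y => psiCut ε (u y) * fderiv ℝ u y e) := by
    filter_upwards [hu.eventually (by simp)] with y hy
    have hd : DifferentiableAt ℝ u y := hy.differentiableAt (by norm_num)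
    have := (phiCut_hasDerivAt ε (u y)).comp_hasFDerivAt y hd.hasFDerivAt
    have h2 : fderiv ℝ (fun y => phiCut ε (u y)) y = psiCut ε (u y) • fderiv ℝ u y := this.fderiv
    rw [h2]; simp
  have hd : DifferentiableAt ℝ u x := hu.differentiableAt (by norm_num)
  have hp := (contDiffAt_partial hu e).differentiableAt (by norm_num)
  have hpsi : HasDerivAt (psiCut ε) (deriv (psiCut ε) (u x)) (u x) :=
    (((psiCut_contDiff ε).differentiable (by norm_num)) (u x)).hasDerivAt
  have h3 := (hpsi.comp_hasFDerivAt x hd.hasFDerivAt).mul hp.hasFDerivAt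
  have h4 : secondPartial (fun y => phiCut ε (u y)) i x
      = psiCut ε (u x) * secondPartial u i x
        + deriv (psiCut ε) (u x) * (fderiv ℝ u x e) ^ 2 := by
    unfold secondPartial
    rw [← he, h1.fderiv_eq]
    have h5 : fderiv ℝ (fun y => psiCut ε (u y) * fderiv ℝ u y e) x = _ := h3.fderiv
    rw [h5]
    simp
    ring
  rw [h4]
  have : 0 ≤ deriv (psiCut ε) (u x) := (psiCut_mono hε).deriv_nonneg
  nlinarith [mul_nonneg this (sq_nonneg (fderiv ℝ u x e))]

/-- Green's identity, one coordinate. -/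
lemma green {Ω : Set (Fin n → ℝ)} {w v : (Fin n → ℝ) → ℝ}
    (hw : ∀ x ∈ Ω, ContDiffAt ℝ 2 w x) (hv : ContDiff ℝ 2 v) (hvc : HasCompactSupport v)
    (hvΩ : tsupport v ⊆ Ω) (i : Fin n) :
    Integrable (fun x => w x * secondPartial v i x - v x * secondPartial w i x) ∧
    ∫ x, (w x * secondPartial v i x - v x * secondPartial w i x) = 0 := by
  set e : Fin n → ℝ := Pi.single i 1 with he
  set F : (Fin n → ℝ) → ℝ := fun y => w y * fderiv ℝ v y e - v y * fderiv ℝ w y e with hF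
  have hF0 : ∀ x, x ∉ tsupport v → F =ᶠ[nhds x] (fun _ => (0 : ℝ)) := by
    intro x hx
    have h := eventually_zero hx
    filter_upwards [h, h.fderiv (𝕜 := ℝ)] with y hy hy'
    simp [hF, hy, hy']
  have hFc : ContDiff ℝ 1 F := by
    rw [contDiff_iff_contDiffAt]
    intro x
    by_cases hx : x ∈ tsupport v
    · have hwx := hw x (hvΩ hx)
      exact ((hwx.of_le (by norm_num)).mul (contDiffAt_partial hv.contDiffAt e)).sub
        ((hv.contDiffAt.of_le (by norm_num)).mul (contDiffAt_partial hwx e))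
    · exact contDiffAt_const.congr_of_eventuallyEq (hF0 x hx)
  have hFs : HasCompactSupport F := by
    refine HasCompactSupport.intro hvc ?_
    intro x hx
    exact (hF0 x hx).eq_of_nhds
  have hFd : (fun x => w x * secondPartial v i x - v x * secondPartial w i x)
      = fun x => fderiv ℝ F x e := by
    funext x
    by_cases hx : x ∈ tsupport v
    · have hwx := hw x (hvΩ hx)
      have a1 := (hwx.differentiableAt (by norm_num)).hasFDerivAt
      have a2 := ((contDiffAt_partial hwx e).differentiableAt (by norm_num)).hasFDerivAt
      have hvx : ContDiffAt ℝ 2 v x := hv.contDiffAt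
      have b1 := (hvx.differentiableAt (by norm_num)).hasFDerivAt
      have b2 := ((contDiffAt_partial hvx e).differentiableAt (by norm_num)).hasFDerivAt
      have h5 : fderiv ℝ F x = _ := ((a1.mul b2).sub (b1.mul a2)).fderiv
      rw [h5]
      simp [secondPartial, ← he]
      ring
    · have h := eventually_zero hx
      rw [(hF0 x hx).fderiv_eq, secondPartial_congr h, secondPartial_zero, h.eq_of_nhds]
      simp
  rw [hFd]
  have hcont : Continuous (fun x => fderiv ℝ F x e) :=
    (hFc.continuous_fderiv (by norm_num)).clm_apply continuous_const
  have hcs : HasCompactSupport (fun x => fderiv ℝ F x e) := hFs.fderiv_apply (𝕜 := ℝ) e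
  have hint := hcont.integrable_of_hasCompactSupport (μ := volume) hcs
  refine ⟨hint, ?_⟩
  have := integral_mul_fderiv_eq_neg_fderiv_mul_of_integrable (μ := volume) (𝕜 := ℝ)
    (f := fun _ : Fin n → ℝ => (1 : ℝ)) (g := F) (v := e) (by simp) (by simpa using hint)
    (by simpa using hFc.continuous.integrable_of_hasCompactSupport hFs)
    (fun x _ => differentiableAt_const _)
    (fun x _ => (hFc.differentiable (by norm_num)) x)
  simpa using this

lemma integrable_aux {Ω : Set (Fin n → ℝ)} (hΩ : IsOpen Ω) {g h : (Fin n → ℝ) → ℝ}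
    {v : (Fin n → ℝ) → ℝ} (hvc : HasCompactSupport v) (hvΩ : tsupport v ⊆ Ω)
    (hg : ContinuousOn g Ω) (hh : Continuous h) (h0 : ∀ x, x ∉ tsupport v → h x = 0) :
    Integrable (fun x => g x * h x) := by
  have hs : HasCompactSupport (fun x => g x * h x) :=
    HasCompactSupport.intro hvc (fun x hx => by simp [h0 x hx])
  have hsub : tsupport (fun x => g x * h x) ⊆ tsupport v := by
    apply closure_minimal _ (isClosed_tsupport v)
    intro x hx
    by_contra hc
    exact hx (by simp [h0 x hc])
  refine Continuous.integrable_of_hasCompactSupport ?_ hs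
  apply continuous_of_tsupport
  intro x hx
  exact ((hg x (hvΩ (hsub hx))).continuousAt (hΩ.mem_nhds (hvΩ (hsub hx)))).mul hh.continuousAt

end

/-- Euclidean version of the Appendix Corollary `viscosity-implies-distrib_cor`:
a nonnegative continuous function `u` satisfying `-aΔu + Vu ≤ f` classically on
the set where it is positive satisfies the inequality distributionally on `Ω`,
i.e. tested against nonnegative smooth compactly supported functions. -/
theorem classical_on_positive_set_implies_distributional
    (n : ℕ) (hn : 1 ≤ n) (Ω : Set (Fin n → ℝ)) (hΩ : IsOpen Ω)
    (a : ℝ) (ha : 0 < a)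
    (V : (Fin n → ℝ) → ℝ) (hV : ContinuousOn V Ω)
    (f : (Fin n → ℝ) → ℝ) (hf : ContinuousOn f Ω) (hf0 : ∀ x ∈ Ω, 0 ≤ f x)
    (u : (Fin n → ℝ) → ℝ) (hu : ContinuousOn u Ω) (hu0 : ∀ x ∈ Ω, 0 ≤ u x)
    (hu2 : ContDiffOn ℝ 2 u {x ∈ Ω | 0 < u x})
    (hineq : ∀ x ∈ {x ∈ Ω | 0 < u x},
      -a * ∑ i, secondPartial u i x + V x * u x ≤ f x) :
    ∀ v : (Fin n → ℝ) → ℝ, ContDiff ℝ (⊤ : ℕ∞) v → HasCompactSupport v →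
      tsupport v ⊆ Ω → (∀ x, 0 ≤ v x) →
      ∫ x in Ω, u x * (-a * ∑ i, secondPartial v i x + V x * v x)
        ≤ ∫ x in Ω, f x * v x := by
  intro v hv hvc hvΩ hv0
  have hv2 : ContDiff ℝ 2 v := contDiff_infty.1 hv 2
  set L : (Fin n → ℝ) → ℝ := fun x => ∑ i, secondPartial v i x with hL
  have hUopen : IsOpen {x ∈ Ω | 0 < u x} := hu.isOpen_inter_preimage hΩ isOpen_Ioi
  have hLc : Continuous L := by
    apply continuous_finsetSum
    intro i _
    have h1 : ContDiff ℝ 1 (fun y => fderiv ℝ v y (Pi.single i 1)) :=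
      contDiff_iff_contDiffAt.2 fun x => contDiffAt_partial hv2.contDiffAt _
    exact (h1.continuous_fderiv (by norm_num)).clm_apply continuous_const
  have hL0 : ∀ x, x ∉ tsupport v → L x = 0 := by
    intro x hx
    apply Finset.sum_eq_zero
    intro i _
    rw [secondPartial_congr (eventually_zero hx), secondPartial_zero]
  have hvz : ∀ x, x ∉ tsupport v → v x = 0 := fun x hx => image_eq_zero_of_notMem_tsupport hx
  have hvcont := hv2.continuous
  have i1 : Integrable (fun x => u x * (-a * L x + V x * v x)) := by
    have h1 := integrable_aux hΩ hvc hvΩ (hu.const_smul (-a)) hLc hL0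
    have h2 := integrable_aux hΩ hvc hvΩ (hu.mul hV) hvcont hvz
    refine (h1.add h2).congr (Filter.Eventually.of_forall fun x => ?_)
    simp
    ring
  have i2 : Integrable (fun x => f x * v x) := integrable_aux hΩ hvc hvΩ hf hvcont hvz
  have i3 : Integrable (fun x => a * |L x| + |V x| * v x) := by
    refine Integrable.add ?_ (integrable_aux hΩ hvc hvΩ hV.abs hvcont hvz)
    exact integrable_aux hΩ hvc hvΩ continuousOn_const hLc.abs (fun x hx => by simp [hL0 x hx])
  rw [setIntegral_eq_integral_of_forall_compl_eq_zero (fun x hx => by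
      have hx' : x ∉ tsupport v := fun h => hx (hvΩ h)
      have := hL0 x hx'
      simp only [hL] at this
      simp [this, hvz x hx']),
    setIntegral_eq_integral_of_forall_compl_eq_zero (fun x hx => by
      have hx' : x ∉ tsupport v := fun h => hx (hvΩ h)
      simp [hvz x hx'])]
  change ∫ x, u x * (-a * L x + V x * v x) ≤ _
  have key : ∀ ε > 0, ∫ x, u x * (-a * L x + V x * v x)
      ≤ (∫ x, f x * v x) + 2 * ε * ∫ x, (a * |L x| + |V x| * v x) := by
    intro ε hε
    set w : (Fin n → ℝ) → ℝ := fun y => phiCut ε (u y) with hwdef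
    have hwz : ∀ x ∈ Ω, u x < ε → w =ᶠ[nhds x] (fun _ => (0 : ℝ)) := by
      intro x hx hux
      have hc := hu.continuousAt (hΩ.mem_nhds hx)
      filter_upwards [hc.eventually (gt_mem_nhds hux)] with y hy
      exact phiCut_zero hε hy.le
    have huU : ∀ x ∈ Ω, 0 < u x → ContDiffAt ℝ 2 u x := fun x hx hux =>
      hu2.contDiffAt (hUopen.mem_nhds ⟨hx, hux⟩)
    have hw : ∀ x ∈ Ω, ContDiffAt ℝ 2 w x := by
      intro x hx
      rcases lt_or_ge 0 (u x) with h | h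
      · exact (phiCut_contDiff ε).contDiffAt.comp x (huU x hx h)
      · exact contDiffAt_const.congr_of_eventuallyEq (hwz x hx (lt_of_le_of_lt h hε))
    have hgr := fun i => green hw hv2 hvc hvΩ i
    set D : (Fin n → ℝ) → ℝ := fun x => ∑ i, (w x * secondPartial v i x - v x * secondPartial w i x)
      with hD
    have hDi : Integrable D := integrable_finsetSum _ fun i _ => (hgr i).1
    have hD0 : ∫ x, D x = 0 := by
      simp only [hD]
      rw [integral_finsetSum _ fun i _ => (hgr i).1]
      exact Finset.sum_eq_zero fun i _ => (hgr i).2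
    have hpt : ∀ x, u x * (-a * L x + V x * v x)
        ≤ f x * v x + 2 * ε * (a * |L x| + |V x| * v x) - a * D x := by
      intro x
      have hDx : D x = w x * L x - v x * ∑ i, secondPartial w i x := by
        simp only [hD, hL]
        rw [Finset.sum_sub_distrib, Finset.mul_sum, Finset.mul_sum]
      by_cases hx : x ∈ tsupport v
      · have hxΩ := hvΩ hx
        have hux := hu0 x hxΩ
        have hvx := hv0 x
        have hwx : |w x - u x| ≤ 2 * ε := by
          rw [abs_le]
          constructor
          · linarith [phiCut_ge hε hux]
          · linarith [phiCut_le (ε := ε) hux]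
        have hpsi := psiCut_mul hε hux
        have hmain : -a * ∑ i, secondPartial w i x ≤ f x - V x * (psiCut ε (u x) * u x) := by
          rcases lt_or_ge 0 (u x) with h | h
          · have h1 : psiCut ε (u x) * ∑ i, secondPartial u i x ≤ ∑ i, secondPartial w i x := by
              rw [Finset.mul_sum]
              exact Finset.sum_le_sum fun i _ => secondPartial_phi_ge hε (huU x hxΩ h) i
            have h2 := mul_le_mul_of_nonneg_left (hineq x ⟨hxΩ, h⟩) (psiCut_nonneg ε (u x))
            have h3 := mul_le_mul_of_nonneg_left h1 ha.le
            have h4 := mul_le_mul_of_nonneg_right (psiCut_le_one ε (u x)) (hf0 x hxΩ)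
            nlinarith
          · have h1 : ∑ i, secondPartial w i x = 0 := Finset.sum_eq_zero fun i _ => by
              rw [secondPartial_congr (hwz x hxΩ (lt_of_le_of_lt h hε)), secondPartial_zero]
            rw [h1, psiCut_zero hε (h.trans hε.le)]
            simpa using hf0 x hxΩ
        have e1 := mul_le_mul_of_nonneg_left hmain hvx
        have e2 : a * ((w x - u x) * L x) ≤ a * (2 * ε * |L x|) := by
          apply mul_le_mul_of_nonneg_left _ ha.le
          refine (le_abs_self _).trans ?_
          rw [abs_mul]
          exact mul_le_mul_of_nonneg_right hwx (abs_nonneg _)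
        have e3 : -((psiCut ε (u x) * u x - u x) * V x) * v x ≤ (2 * ε * |V x|) * v x := by
          apply mul_le_mul_of_nonneg_right _ hvx
          refine (neg_le_abs _).trans ?_
          rw [abs_mul]
          exact mul_le_mul_of_nonneg_right hpsi (abs_nonneg _)
        rw [hDx]
        linarith
      · rw [hDx]
        simp [hL0 x hx, hvz x hx]
    have i4 : Integrable (fun x => f x * v x + 2 * ε * (a * |L x| + |V x| * v x)) :=
      i2.add (i3.const_mul _)
    have hm := integral_mono i1 (i4.sub (hDi.const_mul a)) hpt
    have hs : ∫ x, (f x * v x + 2 * ε * (a * |L x| + |V x| * v x) - a * D x)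
        = (∫ x, f x * v x) + 2 * ε * ∫ x, (a * |L x| + |V x| * v x) := by
      rw [integral_sub i4 (hDi.const_mul a), integral_add i2 (i3.const_mul _),
        integral_const_mul, integral_const_mul, hD0]
      simp
    exact hm.trans hs.le
  set C := ∫ x, (a * |L x| + |V x| * v x) with hC
  have hC0 : 0 ≤ C := integral_nonneg fun x =>
    add_nonneg (mul_nonneg ha.le (abs_nonneg _)) (mul_nonneg (abs_nonneg _) (hv0 x))
  apply le_of_forall_pos_le_add
  intro δ hδ
  have hpos : 0 < 2 * (C + 1) := by linarith
  have hk := key (δ / (2 * (C + 1))) (by positivity)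
  have : 2 * (δ / (2 * (C + 1))) * C ≤ δ := by
    have : 2 * (δ / (2 * (C + 1))) * C = δ * (C / (C + 1)) := by field_simp
    rw [this]
    have : C / (C + 1) ≤ 1 := (div_le_one (by linarith)).2 (by linarith)
    nlinarith
  linarith
end
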